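/- Let N ≥ 1 and let ε₁,…,ε_r ∈ μ_N with ε_r ≠ 1. Then the function (t₁,…,t_r) ↦ ∏_{i=1}^r (ε_i − t_i)^{−1} is integrable on the open simplex {(t₁,…,t_r) ∈ ℝ^r : 0 < t₁ < ⋯ < t_r < 1}, and the integral equals the cyclotomic multiple zeta value ζ(1,1,…,1; ε₂/ε₁, ε₃/ε₂, …, ε_r/ε_{r−1}, 1/ε_r), i.e. the limit as M → ∞ of ∑_{0 < n₁ < ⋯ < n_r ≤ M} (ε₂/ε₁)^{n₁}(ε₃/ε₂)^{n₂}⋯(ε_r/ε_{r−1})^{n_{r−1}}(1/ε_r)^{n_r} / (n₁ n₂ ⋯ n_r). -/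

import Mathlib

open Filter Topology MeasureTheory

/-- Partial sum `∑_{0 < n₁ < ⋯ < n_r ≤ M} ε₁^{n₁}⋯ε_r^{n_r} / (n₁^{k₁}⋯n_r^{k_r})`
of the series defining a cyclotomic multiple zeta value. -/
noncomputable def cmzvPartial (r : ℕ) (k : Fin r → ℕ) (ε : Fin r → ℂ) (M : ℕ) : ℂ :=
  ∑ n ∈ (Fintype.piFinset fun _ : Fin r => Finset.Icc 1 M).filter
      (fun n => ∀ i j : Fin r, i < j → n i < n j),
    ∏ i, ε i ^ n i / (n i : ℂ) ^ k i

/-- The open unit simplex `{t : 0 < t₁ < ⋯ < t_r < 1}`. -/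
def openSimplex (r : ℕ) : Set (Fin r → ℝ) :=
  {t | (∀ i, 0 < t i ∧ t i < 1) ∧ ∀ i j : Fin r, i < j → t i < t j}


/-- coefficients -/
noncomputable def coefA : (r : ℕ) → (Fin r → ℂ) → ℕ → ℂ
  | 0, _, n => if n = 0 then 1 else 0
  | r + 1, ε, n => (ε (Fin.last r))⁻¹ ^ n / (n : ℂ) *
      ∑ m ∈ Finset.range n, ε (Fin.last r) ^ m * coefA r (Fin.init ε) m

lemma sum_inv_sqrt_le (n : ℕ) :
    ∑ m ∈ Finset.range n, 1 / √((m : ℝ) + 1) ≤ 2 * √(n : ℝ) := by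
  induction n with
  | zero => simp
  | succ n ih =>
    rw [Finset.sum_range_succ]
    push_cast
    have h1 : √((n : ℝ) + 1) ^ 2 = n + 1 := Real.sq_sqrt (by positivity)
    have h2 : √(n : ℝ) ^ 2 = n := Real.sq_sqrt (by positivity)
    have h3 : 0 < √((n : ℝ) + 1) := Real.sqrt_pos.2 (by positivity)
    have h4 : 1 / √((n : ℝ) + 1) ≤ 2 * √((n : ℝ) + 1) - 2 * √(n : ℝ) := by
      rw [div_le_iff₀ h3]
      nlinarith [sq_nonneg (√((n : ℝ) + 1) - √(n : ℝ))]
    linarith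

lemma norm_sum_le_of_bound (a : ℕ → ℂ) (C : ℝ) 
    (ha : ∀ n, ‖a n‖ ≤ C * (1 / √((n : ℝ) + 1))) (hC : 0 ≤ C) (e : ℂ) (he : ‖e‖ = 1) (n : ℕ) :
    ‖∑ m ∈ Finset.range n, e ^ m * a m‖ ≤ C * (2 * √(n : ℝ)) := by
  calc _ ≤ ∑ m ∈ Finset.range n, C * (1 / √((m : ℝ) + 1)) := by
        refine norm_sum_le_of_le _ fun m _ => ?_
        simpa [he] using ha m
    _ ≤ _ := by
        rw [← Finset.mul_sum]
        exact mul_le_mul_of_nonneg_left (sum_inv_sqrt_le n) hC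

lemma coefA_bound (r : ℕ) : ∀ ε : Fin r → ℂ, (∀ i, ‖ε i‖ = 1) → ∀ n,
    ‖coefA r ε n‖ ≤ 4 ^ r * (1 / √((n : ℝ) + 1)) := by
  induction r with
  | zero =>
    intro ε _ n
    rcases Nat.eq_zero_or_pos n with rfl | h
    · simp [coefA]
    · simp [coefA, h.ne']
  | succ r ih =>
    intro ε hε n
    have h := norm_sum_le_of_bound _ _ (ih (Fin.init ε) (fun i => hε _)) (by positivity)
      (ε (Fin.last r)) (hε _) n
    rcases Nat.eq_zero_or_pos n with rfl | hn
    · simp [coefA]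
    have hn' : (1 : ℝ) ≤ n := by exact_mod_cast hn
    have h2 : √(n : ℝ) ^ 2 = n := Real.sq_sqrt (by positivity)
    have h3 : 0 < √((n : ℝ) + 1) := Real.sqrt_pos.2 (by positivity)
    have h5 : √((n : ℝ) + 1) ≤ 2 * √(n : ℝ) := by
      rw [Real.sqrt_le_left (by positivity)]
      nlinarith
    rw [coefA, norm_mul, norm_div, norm_pow, norm_inv, hε]
    simp only [inv_one, one_pow, RCLike.norm_natCast]
    calc _ ≤ 1 / (n : ℝ) * (4 ^ r * (2 * √(n : ℝ))) := by gcongr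
      _ ≤ _ := by
        rw [div_mul_eq_mul_div, mul_one_div, div_le_div_iff₀ (by positivity) h3, pow_succ]
        have : √(n : ℝ) * √((n : ℝ) + 1) ≤ 2 * n := by
          nlinarith [Real.sqrt_nonneg (n : ℝ)]
        have h4 : (0 : ℝ) < 4 ^ r := by positivity
        nlinarith

lemma poly_identity (a : ℕ → ℂ) (e s : ℂ) (he : e ≠ 0) (hs : e - s ≠ 0) (M : ℕ) :
    ∑ n ∈ Finset.range M, e⁻¹ ^ (n + 1) * s ^ n * ∑ m ∈ Finset.range (n + 1), e ^ m * a m =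
      ∑ m ∈ Finset.range M, a m * ((e - s)⁻¹ * s ^ m) -
        e⁻¹ ^ M * (∑ m ∈ Finset.range M, e ^ m * a m) * ((e - s)⁻¹ * s ^ M) := by
  induction M with
  | zero => simp
  | succ M ih =>
    rw [Finset.sum_range_succ, ih, Finset.sum_range_succ _ M, Finset.sum_range_succ _ M]
    simp only [inv_pow]
    field_simp
    ring

lemma integral_pow_Ioo (x : ℝ) (hx : 0 ≤ x) (n : ℕ) :
    ∫ s in Set.Ioo 0 x, s ^ n = x ^ (n + 1) / ((n : ℝ) + 1) := by
  rw [← integral_Ioc_eq_integral_Ioo, ← intervalIntegral.integral_of_le hx, integral_pow]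
  simp

lemma integral_cpow_Ioo (x : ℝ) (hx : 0 ≤ x) (n : ℕ) :
    ∫ s in Set.Ioo 0 x, (s : ℂ) ^ n = (x : ℂ) ^ (n + 1) / ((n : ℂ) + 1) := by
  have := integral_pow_Ioo x hx n
  have h2 : ∫ s in Set.Ioo 0 x, (s : ℂ) ^ n = ((∫ s in Set.Ioo 0 x, s ^ n : ℝ) : ℂ) := by
    rw [← integral_complex_ofReal]
    simp
  rw [h2, this]; push_cast; rfl

lemma integrableOn_pow_Ioo (x : ℝ) (n : ℕ) :
    IntegrableOn (fun s : ℝ => s ^ n) (Set.Ioo 0 x) := 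
  ((continuous_pow n).integrableOn_Icc (a := 0) (b := x)).mono_set Set.Ioo_subset_Icc_self

lemma integrableOn_cpow_Ioo (x : ℝ) (n : ℕ) :
    IntegrableOn (fun s : ℝ => (s : ℂ) ^ n) (Set.Ioo 0 x) := 
  ((Complex.continuous_ofReal.pow n).integrableOn_Icc (a := 0) (b := x)).mono_set
    Set.Ioo_subset_Icc_self

lemma summable_aux (a : ℕ → ℂ) (C : ℝ) 
    (ha : ∀ n, ‖a n‖ ≤ C * (1 / √((n : ℝ) + 1))) : 
    Summable (fun n => ‖a n‖ * (1 / ((n : ℝ) + 1))) := by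
  have h : Summable (fun n : ℕ => C * (1 / ((n + 1 : ℕ) : ℝ) ^ (3 / 2 : ℝ))) :=
    (((Real.summable_one_div_nat_rpow (p := 3 / 2)).2 (by norm_num)).comp_injective
      (add_left_injective 1)).mul_left C
  refine h.of_nonneg_of_le (fun n => by positivity) fun n => ?_
  calc _ ≤ C * (1 / √((n : ℝ) + 1)) * (1 / ((n : ℝ) + 1)) := by gcongr; exact ha n
    _ = _ := by
      push_cast
      rw [mul_assoc, Real.sqrt_eq_rpow, one_div_mul_one_div]
      congr 2
      have : (0 : ℝ) < n + 1 := by positivity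
      rw [show (3 / 2 : ℝ) = 1 / 2 + 1 by norm_num, Real.rpow_add this, Real.rpow_one]

lemma step_analytic (a : ℕ → ℂ) (C : ℝ) (hC : 0 ≤ C)
    (ha : ∀ n, ‖a n‖ ≤ C * (1 / √((n : ℝ) + 1))) (e : ℂ) (he : ‖e‖ = 1) (x : ℝ) (hx0 : 0 ≤ x)
    (hx1 : x ≤ 1) (K : ℝ) (hK : ∀ s ∈ Set.Ioo 0 x, ‖(e - (s : ℂ))⁻¹‖ ≤ K) :
    Tendsto (fun M : ℕ => ∑ n ∈ Finset.range (M + 1),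
        (e⁻¹ ^ n / (n : ℂ) * ∑ m ∈ Finset.range n, e ^ m * a m) * (x : ℂ) ^ n) atTop
      (𝓝 (∫ s in Set.Ioo 0 x, (e - (s : ℂ))⁻¹ * ∑' n, a n * (s : ℂ) ^ n)) := by
  have he0 : e ≠ 0 := by rintro rfl; simp at he
  have hes : ∀ s ∈ Set.Ioo 0 x, e - (s : ℂ) ≠ 0 := by
    intro s hs h
    rw [sub_eq_zero] at h
    rw [h, Complex.norm_real, Real.norm_eq_abs, abs_of_pos hs.1] at he
    linarith [hs.2]
  have hgm : Measurable (fun s : ℝ => (e - (s : ℂ))⁻¹) := by fun_prop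
  have hint : ∀ n : ℕ, IntegrableOn (fun s : ℝ => (e - (s : ℂ))⁻¹ * (s : ℂ) ^ n)
      (Set.Ioo 0 x) := fun n =>
    Integrable.bdd_mul (c := K) (integrableOn_cpow_Ioo x n) hgm.aestronglyMeasurable
      (ae_restrict_of_forall_mem measurableSet_Ioo hK)
  have hbd : ∀ n : ℕ, ∫ s in Set.Ioo 0 x, ‖(e - (s : ℂ))⁻¹ * (s : ℂ) ^ n‖
      ≤ |K| * (1 / ((n : ℝ) + 1)) := by
    intro n
    calc _ ≤ ∫ s in Set.Ioo 0 x, |K| * s ^ n := by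
          refine setIntegral_mono_on (hint n).norm ((integrableOn_pow_Ioo x n).const_mul _)
            measurableSet_Ioo fun s hs => ?_
          rw [norm_mul, norm_pow, Complex.norm_real, Real.norm_eq_abs, abs_of_pos hs.1]
          have := hs.1
          gcongr
          exact (hK s hs).trans (le_abs_self _)
      _ = |K| * (x ^ (n + 1) / ((n : ℝ) + 1)) := by
          rw [integral_const_mul, integral_pow_Ioo x hx0]
      _ ≤ _ := by
          gcongr
          exact pow_le_one₀ hx0 hx1
  -- rewriting partial sums
  have key : ∀ M : ℕ, ∑ n ∈ Finset.range (M + 1),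
        (e⁻¹ ^ n / (n : ℂ) * ∑ m ∈ Finset.range n, e ^ m * a m) * (x : ℂ) ^ n =
      ∑ m ∈ Finset.range M, (∫ s in Set.Ioo 0 x, a m * ((e - (s : ℂ))⁻¹ * (s : ℂ) ^ m)) -
        e⁻¹ ^ M * (∑ m ∈ Finset.range M, e ^ m * a m) *
          ∫ s in Set.Ioo 0 x, (e - (s : ℂ))⁻¹ * (s : ℂ) ^ M := by
    intro M
    rw [← integral_const_mul, ← integral_finsetSum _ (fun m _ => (hint m).const_mul _),
      ← integral_sub (integrable_finsetSum _ (fun m _ => (hint m).const_mul _))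
        ((hint M).const_mul _), Finset.sum_range_succ']
    simp only [Finset.range_zero, Finset.sum_empty, mul_zero, zero_mul, add_zero]
    rw [← setIntegral_congr_fun measurableSet_Ioo
      (fun (s : ℝ) hs => poly_identity a e (s : ℂ) he0 (hes s hs) M)]
    rw [integral_finsetSum]
    · refine Finset.sum_congr rfl fun n _ => ?_
      rw [integral_mul_const, integral_const_mul, integral_cpow_Ioo x hx0]
      push_cast
      ring
    · intro n _
      exact ((integrableOn_cpow_Ioo x n).const_mul _).mul_const _
  simp_rw [key]
  rw [← sub_zero (∫ s in Set.Ioo 0 x, _)]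
  refine Tendsto.sub ?_ ?_
  · have : ∀ s : ℝ, (e - (s : ℂ))⁻¹ * ∑' n, a n * (s : ℂ) ^ n =
        ∑' n, a n * ((e - (s : ℂ))⁻¹ * (s : ℂ) ^ n) := by
      intro s
      rw [← tsum_mul_left]
      congr 1; ext n; ring
    simp_rw [this]
    refine (hasSum_integral_of_summable_integral_norm (fun n => (hint n).const_mul _)
      ?_).tendsto_sum_nat
    refine ((summable_aux a C ha).mul_left |K|).of_nonneg_of_le
      (fun n => integral_nonneg fun _ => norm_nonneg _) fun n => ?_
    simp_rw [norm_mul (a n)]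
    rw [integral_const_mul]
    calc _ ≤ ‖a n‖ * (|K| * (1 / ((n : ℝ) + 1))) := by gcongr; exact hbd n
      _ = _ := by ring
  · have hlim : Tendsto (fun M : ℕ => 2 * C * |K| * (1 / √(M : ℝ))) atTop (𝓝 0) := by
      rw [← mul_zero (2 * C * |K|)]
      refine Tendsto.const_mul _ ?_
      simp_rw [one_div]
      exact (Real.tendsto_sqrt_atTop.comp tendsto_natCast_atTop_atTop).inv_tendsto_atTop
    refine squeeze_zero_norm (fun M => ?_) hlim
    rw [norm_mul, norm_mul, norm_pow, norm_inv, he]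
    have h1 := norm_sum_le_of_bound a C ha hC e he M
    have h2 := (norm_integral_le_integral_norm _).trans (hbd M)
    calc _ ≤ 1 * (C * (2 * √(M : ℝ))) * (|K| * (1 / ((M : ℝ) + 1))) := by
          simp only [inv_one, one_pow]
          gcongr
      _ = 2 * C * |K| * (√(M : ℝ) / ((M : ℝ) + 1)) := by ring
      _ ≤ _ := by
        refine mul_le_mul_of_nonneg_left ?_ (by positivity)
        rcases Nat.eq_zero_or_pos M with rfl | hM
        · simp
        have : (0 : ℝ) < M := by exact_mod_cast hM
        rw [div_le_div_iff₀ (by positivity) (by positivity), Real.mul_self_sqrt this.le]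
        linarith

lemma integrable_tsum (a : ℕ → ℂ) (C : ℝ) 
    (ha : ∀ n, ‖a n‖ ≤ C * (1 / √((n : ℝ) + 1))) (x : ℝ) (hx0 : 0 ≤ x) (hx1 : x ≤ 1) :
    IntegrableOn (fun s : ℝ => ∑' n, a n * (s : ℂ) ^ n) (Set.Ioo 0 x) := by
  have hC : 0 ≤ C := by simpa using (norm_nonneg _).trans (ha 0)
  have hsm : ∀ s ∈ Set.Ioo 0 x, Summable (fun n => a n * (s : ℂ) ^ n) := by
    intro s hs
    refine Summable.of_norm_bounded (g := fun n => C * s ^ n)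
      ((summable_geometric_of_lt_one hs.1.le (hs.2.trans_le hx1)).mul_left _) fun n => ?_
    rw [norm_mul, norm_pow, Complex.norm_real, Real.norm_of_nonneg hs.1.le]
    have := hs.1
    gcongr
    refine (ha n).trans (mul_le_of_le_one_right hC ?_)
    rw [div_le_one (by positivity), Real.one_le_sqrt]
    linarith [Nat.cast_nonneg (α := ℝ) n]
  refine ⟨?_, ?_⟩
  · refine aestronglyMeasurable_of_tendsto_ae atTop
      (f := fun (M : ℕ) (s : ℝ) => ∑ n ∈ Finset.range M, a n * (s : ℂ) ^ n) (fun M => ?_) ?_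
    · exact Continuous.aestronglyMeasurable (by fun_prop)
    · exact ae_restrict_of_forall_mem measurableSet_Ioo
        fun s hs => (hsm s hs).hasSum.tendsto_sum_nat
  · have hb : ∀ n : ℕ, ∫⁻ s in Set.Ioo 0 x, ‖a n * (s : ℂ) ^ n‖ₑ ≤
        ENNReal.ofReal (‖a n‖ * (1 / ((n : ℝ) + 1))) := by
      intro n
      have hi : IntegrableOn (fun s : ℝ => a n * (s : ℂ) ^ n) (Set.Ioo 0 x) :=
        (integrableOn_cpow_Ioo x n).const_mul _
      rw [← ofReal_integral_norm_eq_lintegral_enorm hi]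
      refine ENNReal.ofReal_le_ofReal ?_
      calc _ = ∫ s in Set.Ioo 0 x, ‖a n‖ * s ^ n := by
            refine setIntegral_congr_fun measurableSet_Ioo fun s hs => ?_
            simp only [norm_mul, norm_pow, Complex.norm_real, Real.norm_of_nonneg hs.1.le]
        _ = ‖a n‖ * (x ^ (n + 1) / ((n : ℝ) + 1)) := by
            rw [integral_const_mul, integral_pow_Ioo x hx0]
        _ ≤ _ := by
            gcongr
            exact pow_le_one₀ hx0 hx1
    unfold HasFiniteIntegral
    calc _ ≤ ∫⁻ s in Set.Ioo 0 x, ∑' n, ‖a n * (s : ℂ) ^ n‖ₑ :=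
          lintegral_mono fun s => enorm_tsum_le_tsum_enorm
      _ = ∑' n, ∫⁻ s in Set.Ioo 0 x, ‖a n * (s : ℂ) ^ n‖ₑ :=
          lintegral_tsum fun n => by fun_prop
      _ ≤ ∑' n, ENNReal.ofReal (‖a n‖ * (1 / ((n : ℝ) + 1))) := ENNReal.tsum_le_tsum hb
      _ < ⊤ := (summable_aux a C ha).tsum_ofReal_lt_top

/-- truncated simplex -/
def simplexTo (r : ℕ) (x : ℝ) : Set (Fin r → ℝ) :=
  {t | (∀ i, 0 < t i ∧ t i < x) ∧ ∀ i j : Fin r, i < j → t i < t j}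

noncomputable def prodP (r : ℕ) (ε : Fin r → ℂ) (t : Fin r → ℝ) : ℂ := ∏ i, (ε i - (t i : ℂ))⁻¹

lemma measurable_prodP (r : ℕ) (ε : Fin r → ℂ) : Measurable (prodP r ε) := by
  unfold prodP; fun_prop

lemma measurableSet_simplexTo (r : ℕ) (x : ℝ) : MeasurableSet (simplexTo r x) := by
  have h : simplexTo r x = (⋂ i : Fin r, {t : Fin r → ℝ | 0 < t i} ∩ {t : Fin r → ℝ | t i < x}) ∩
      ⋂ i : Fin r, ⋂ j : Fin r, ⋂ _ : i < j, {t : Fin r → ℝ | t i < t j} := by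
    ext t
    simp [simplexTo]
  rw [h]
  refine MeasurableSet.inter (MeasurableSet.iInter fun i => MeasurableSet.inter ?_ ?_)
    (MeasurableSet.iInter fun i => MeasurableSet.iInter fun j => MeasurableSet.iInter fun _ => ?_)
  · exact measurableSet_lt measurable_const (measurable_pi_apply i)
  · exact measurableSet_lt (measurable_pi_apply i) measurable_const
  · exact measurableSet_lt (measurable_pi_apply i) (measurable_pi_apply j)

noncomputable def Phi (r : ℕ) (ε : Fin (r + 1) → ℂ) (x : ℝ) (p : ℝ × (Fin r → ℝ)) : ℂ :=
  (Set.Ioo 0 x).indicator (fun s : ℝ => (ε (Fin.last r) - (s : ℂ))⁻¹ *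
    (simplexTo r s).indicator (prodP r (Fin.init ε)) p.2) p.1

lemma mem_simplexTo_succ (r : ℕ) (x : ℝ) (t : Fin (r + 1) → ℝ) : t ∈ simplexTo (r + 1) x ↔
    t (Fin.last r) ∈ Set.Ioo 0 x ∧ Fin.init t ∈ simplexTo r (t (Fin.last r)) := by
  unfold simplexTo
  simp only [Set.mem_ofPred_eq, Fin.forall_fin_succ', Set.mem_Ioo, Fin.init]
  constructor
  · rintro ⟨⟨h1, h2⟩, h3, h4⟩
    exact ⟨h2, fun i => ⟨(h1 i).1, (h3 i).2 (Fin.castSucc_lt_last i)⟩,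
      fun i j h => (h3 i).1 j (by simpa using h)⟩
  · rintro ⟨h2, h1, h3⟩
    refine ⟨⟨fun i => ⟨(h1 i).1, (h1 i).2.trans h2.2⟩, h2⟩, fun i => ⟨fun j h => h3 i j (by simpa using h), fun _ => (h1 i).2⟩, fun j h => ?_, fun h => ?_⟩
    · exact absurd h (by simp [Fin.le_last])
    · exact absurd h (by simp)

lemma Phi_comp (r : ℕ) (ε : Fin (r + 1) → ℂ) (x : ℝ) (t : Fin (r + 1) → ℝ) :
    Phi r ε x (MeasurableEquiv.piFinSuccAbove (fun _ => ℝ) (Fin.last r) t) =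
      (simplexTo (r + 1) x).indicator (prodP (r + 1) ε) t := by
  have h1 : MeasurableEquiv.piFinSuccAbove (fun _ => ℝ) (Fin.last r) t =
      (t (Fin.last r), Fin.init t) := by
    ext i <;> simp [MeasurableEquiv.piFinSuccAbove, Fin.init]
  rw [h1]
  unfold Phi
  by_cases h : t (Fin.last r) ∈ Set.Ioo 0 x
  · by_cases h' : Fin.init t ∈ simplexTo r (t (Fin.last r))
    · rw [Set.indicator_of_mem h, Set.indicator_of_mem h',
        Set.indicator_of_mem ((mem_simplexTo_succ r x t).2 ⟨h, h'⟩)]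
      unfold prodP
      rw [Fin.prod_univ_castSucc, mul_comm]
      rfl
    · rw [Set.indicator_of_mem h, Set.indicator_of_notMem h', Set.indicator_of_notMem, mul_zero]
      rw [mem_simplexTo_succ]; tauto
  · rw [Set.indicator_of_notMem h, Set.indicator_of_notMem]
    rw [mem_simplexTo_succ]; tauto

lemma measurable_Phi (r : ℕ) (ε : Fin (r + 1) → ℂ) (x : ℝ) : Measurable (Phi r ε x) := by
  have h : Phi r ε x = (simplexTo (r + 1) x).indicator (prodP (r + 1) ε) ∘
      (MeasurableEquiv.piFinSuccAbove (fun _ => ℝ) (Fin.last r)).symm := by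
    ext p
    rw [Function.comp_apply, ← Phi_comp, MeasurableEquiv.apply_symm_apply]
  rw [h]
  exact ((measurable_prodP _ _).indicator (measurableSet_simplexTo _ _)).comp
    (MeasurableEquiv.measurable _)

lemma integrableOn_iff_Phi (r : ℕ) (ε : Fin (r + 1) → ℂ) (x : ℝ) :
    IntegrableOn (prodP (r + 1) ε) (simplexTo (r + 1) x) ↔ Integrable (Phi r ε x) := by
  rw [← integrable_indicator_iff (measurableSet_simplexTo _ _),
    ← (volume_preserving_piFinSuccAbove (fun _ => ℝ) (Fin.last r)).integrable_comp_emb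
      (MeasurableEquiv.measurableEmbedding _)]
  congr! 1
  ext t
  exact (Phi_comp r ε x t).symm

lemma integral_eq_Phi (r : ℕ) (ε : Fin (r + 1) → ℂ) (x : ℝ) :
    ∫ t in simplexTo (r + 1) x, prodP (r + 1) ε t = ∫ p, Phi r ε x p := by
  rw [← integral_indicator (measurableSet_simplexTo _ _),
    ← (volume_preserving_piFinSuccAbove (fun _ => ℝ) (Fin.last r)).integral_comp
      (MeasurableEquiv.measurableEmbedding _)]
  congr 1
  ext t
  exact (Phi_comp r ε x t).symm

lemma integral_Phi_slice (r : ℕ) (ε : Fin (r + 1) → ℂ) (x s : ℝ) :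
    ∫ y, Phi r ε x (s, y) = (Set.Ioo 0 x).indicator (fun s : ℝ => (ε (Fin.last r) - (s : ℂ))⁻¹ *
      ∫ t in simplexTo r s, prodP r (Fin.init ε) t) s := by
  unfold Phi
  by_cases h : s ∈ Set.Ioo 0 x
  · simp only [Set.indicator_of_mem h]
    rw [integral_const_mul, integral_indicator (measurableSet_simplexTo _ _)]
  · simp only [Set.indicator_of_notMem h]
    simp

lemma integral_norm_le (r : ℕ) (ε : Fin r → ℂ) (hε : ∀ i, ‖ε i‖ = 1) (s : ℝ) (hs : s ≤ 1)
    (h1 : IntegrableOn (prodP r ε) (simplexTo r s))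
    (h2 : IntegrableOn (prodP r 1) (simplexTo r s)) :
    ∫ t in simplexTo r s, ‖prodP r ε t‖ ≤ ‖∫ t in simplexTo r s, prodP r 1 t‖ := by
  have h3 : ∀ t, prodP r 1 t = ((∏ i, (1 - t i)⁻¹ : ℝ) : ℂ) := by
    intro t; simp [prodP]
  have h4 : ∫ t in simplexTo r s, prodP r 1 t = ((∫ t in simplexTo r s, ∏ i, (1 - t i)⁻¹ : ℝ) : ℂ) := by
    simp_rw [h3]
    exact integral_complex_ofReal
  have h5 : IntegrableOn (fun t : Fin r → ℝ => ∏ i, (1 - t i)⁻¹) (simplexTo r s) := by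
    have h6 : Integrable (fun t => (prodP r 1 t).re) (volume.restrict (simplexTo r s)) := h2.re
    simp_rw [h3, Complex.ofReal_re] at h6
    exact h6
  rw [h4, Complex.norm_real]
  refine le_trans ?_ (Real.le_norm_self _)
  refine setIntegral_mono_on h1.norm h5 (measurableSet_simplexTo _ _) fun t ht => ?_
  unfold prodP
  rw [norm_prod]
  refine Finset.prod_le_prod (fun _ _ => norm_nonneg _) fun i _ => ?_
  have hti := ht.1 i
  rw [norm_inv]
  have : 0 < 1 - t i := by linarith
  gcongr
  have := norm_sub_norm_le (ε i) (t i : ℂ)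
  rwa [hε, Complex.norm_real, Real.norm_eq_abs, abs_of_pos hti.1] at this

def Q (r : ℕ) : Prop := ∀ ε : Fin r → ℂ, (∀ i, ‖ε i‖ = 1) → ∀ x : ℝ, 0 ≤ x → x < 1 →
  IntegrableOn (prodP r ε) (simplexTo r x) ∧
    ∫ t in simplexTo r x, prodP r ε t = ∑' n, coefA r ε n * (x : ℂ) ^ n

lemma main_step (r : ℕ) (hQ : Q r) (ε : Fin (r + 1) → ℂ) (hε : ∀ i, ‖ε i‖ = 1) (x : ℝ)
    (hx0 : 0 ≤ x) (hx1 : x ≤ 1) (K : ℝ)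
    (hK : ∀ s ∈ Set.Ioo 0 x, ‖(ε (Fin.last r) - (s : ℂ))⁻¹‖ ≤ K) :
    IntegrableOn (prodP (r + 1) ε) (simplexTo (r + 1) x) ∧
    Tendsto (fun M : ℕ => ∑ n ∈ Finset.range (M + 1), coefA (r + 1) ε n * (x : ℂ) ^ n) atTop
      (𝓝 (∫ t in simplexTo (r + 1) x, prodP (r + 1) ε t)) := by
  have hε' : ∀ i, ‖Fin.init ε i‖ = 1 := fun i => hε _
  have hQ1 : ∀ s ∈ Set.Ioo 0 x, _ := fun s hs => hQ (Fin.init ε) hε' s hs.1.le (hs.2.trans_le hx1)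
  have hQ2 : ∀ s ∈ Set.Ioo 0 x, _ := fun s hs => hQ 1 (by simp) s hs.1.le (hs.2.trans_le hx1)
  have hI : Integrable (Phi r ε x) := by
    rw [Measure.volume_eq_prod, integrable_prod_iff (measurable_Phi r ε x).aestronglyMeasurable]
    constructor
    · refine Eventually.of_forall fun s => ?_
      unfold Phi
      by_cases h : s ∈ Set.Ioo 0 x
      · simp only [Set.indicator_of_mem h]
        exact ((integrable_indicator_iff (measurableSet_simplexTo _ _)).2 (hQ1 s h).1).const_mul _
      · simp only [Set.indicator_of_notMem h]
        simp
    · have hT := integrable_tsum (coefA r 1) (4 ^ r) (coefA_bound r 1 (by simp)) x hx0 hx1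
      have hT2 := (integrable_indicator_iff measurableSet_Ioo).2 (hT.norm.const_mul |K|)
      refine hT2.mono'
        (measurable_Phi r ε x).norm.stronglyMeasurable.integral_prod_right.aestronglyMeasurable
        (Eventually.of_forall fun s => ?_)
      rw [Real.norm_of_nonneg (integral_nonneg fun _ => norm_nonneg _)]
      unfold Phi
      by_cases h : s ∈ Set.Ioo 0 x
      · simp only [Set.indicator_of_mem h, norm_mul]
        rw [integral_const_mul, ← (hQ2 s h).2]
        simp_rw [norm_indicator_eq_indicator_norm]
        rw [integral_indicator (measurableSet_simplexTo _ _)]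
        have h5 := integral_norm_le r (Fin.init ε) hε' s (h.2.le.trans hx1) (hQ1 s h).1 (hQ2 s h).1
        have h6 := (hK s h).trans (le_abs_self K)
        gcongr
      · simp only [Set.indicator_of_notMem h]
        simp
  refine ⟨(integrableOn_iff_Phi r ε x).2 hI, ?_⟩
  rw [integral_eq_Phi, Measure.volume_eq_prod, integral_prod _ hI]
  simp_rw [integral_Phi_slice]
  rw [integral_indicator measurableSet_Ioo,
    setIntegral_congr_fun measurableSet_Ioo (fun s hs => congrArg _ (hQ1 s hs).2)]
  exact step_analytic (coefA r (Fin.init ε)) (4 ^ r) (by positivity) (coefA_bound r _ hε') _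
    (hε _) x hx0 hx1 K hK

lemma summable_coef (r : ℕ) (ε : Fin r → ℂ) (hε : ∀ i, ‖ε i‖ = 1) (x : ℝ) (hx0 : 0 ≤ x)
    (hx1 : x < 1) : Summable (fun n => coefA r ε n * (x : ℂ) ^ n) := by
  refine Summable.of_norm_bounded (g := fun n => 4 ^ r * x ^ n)
    ((summable_geometric_of_lt_one hx0 hx1).mul_left _) fun n => ?_
  rw [norm_mul, norm_pow, Complex.norm_real, Real.norm_of_nonneg hx0]
  gcongr
  refine (coefA_bound r ε hε n).trans ?_
  refine mul_le_of_le_one_right (by positivity) ?_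
  rw [div_le_one (by positivity), Real.one_le_sqrt]
  linarith [Nat.cast_nonneg (α := ℝ) n]

lemma Q_all (r : ℕ) : Q r := by
  induction r with
  | zero =>
    intro ε hε x hx0 hx1
    have h : simplexTo 0 x = Set.univ := by ext t; simp [simplexTo]
    have h2 : prodP 0 ε = fun _ => 1 := by ext t; simp [prodP]
    have h3 : ∑' n, coefA 0 ε n * (x : ℂ) ^ n = 1 := by
      rw [tsum_eq_single 0]
      · simp [coefA]
      · intro n hn; simp [coefA, hn]
    rw [h, h2, h3]
    constructor
    · rw [integrableOn_univ]
      exact integrable_const _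
    · simp [Measure.volume_pi_eq_dirac (fun i : Fin 0 => (0 : ℝ)), measureReal_def]
  | succ r ih =>
    intro ε hε x hx0 hx1
    obtain ⟨h1, h2⟩ := main_step r ih ε hε x hx0 hx1.le (1 - x)⁻¹ (by
      intro s hs
      rw [norm_inv]
      have := hs.2
      have h3 : 0 < 1 - x := by linarith
      gcongr
      have h4 := norm_sub_norm_le (ε (Fin.last r)) (s : ℂ)
      rw [hε, Complex.norm_real, Real.norm_eq_abs, abs_of_pos hs.1] at h4
      linarith)
    refine ⟨h1, tendsto_nhds_unique h2 ?_⟩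
    exact (summable_coef _ ε hε x hx0 hx1).hasSum.tendsto_sum_nat.comp (tendsto_add_atTop_nat 1)

lemma cmzv_succ (r : ℕ) (η : Fin (r + 1) → ℂ) (M : ℕ) :
    cmzvPartial (r + 1) (fun _ => 1) η M = ∑ k ∈ Finset.range (M + 1),
      η (Fin.last r) ^ k / (k : ℂ) * cmzvPartial r (fun _ => 1) (Fin.init η) (k - 1) := by
  rw [Finset.sum_range_succ']
  simp only [Nat.cast_zero, div_zero, zero_mul, add_zero, Nat.add_sub_cancel]
  unfold cmzvPartial
  simp_rw [Finset.mul_sum]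
  rw [Finset.sum_sigma']
  refine Finset.sum_bij' (fun n _ => ⟨n (Fin.last r) - 1, Fin.init n⟩)
    (fun p _ => Fin.snoc p.2 (p.1 + 1)) ?_ ?_ ?_ ?_ ?_
  · intro n hn
    simp only [Finset.mem_filter, Fintype.mem_piFinset, Finset.mem_Icc, Finset.mem_sigma,
      Finset.mem_range, Fin.init] at hn ⊢
    obtain ⟨h1, h2⟩ := hn
    have h3 := h1 (Fin.last r)
    refine ⟨by omega, fun i => ⟨(h1 _).1, ?_⟩, fun i j h => h2 _ _ (by simpa using h)⟩
    have := h2 _ _ (Fin.castSucc_lt_last i)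
    omega
  · rintro ⟨k, n⟩ hn
    simp only [Finset.mem_filter, Fintype.mem_piFinset, Finset.mem_Icc, Finset.mem_sigma,
      Finset.mem_range, Fin.forall_fin_succ', Fin.snoc_castSucc, Fin.snoc_last] at hn ⊢
    obtain ⟨h0, h1, h2⟩ := hn
    refine ⟨⟨fun i => ⟨(h1 i).1, by have := (h1 i).2; omega⟩, by omega, by omega⟩,
      fun i => ⟨fun j h => h2 i j (by simpa using h), fun _ => by have := (h1 i).2; omega⟩,
      fun j h => absurd h (by simp [Fin.le_last]), fun h => absurd h (by simp)⟩
  · intro n hn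
    simp only [Finset.mem_filter, Fintype.mem_piFinset, Finset.mem_Icc] at hn
    have := (hn.1 (Fin.last r)).1
    simp only [Nat.sub_add_cancel this]
    exact Fin.snoc_init_self n
  · rintro ⟨k, n⟩ hn
    simp
  · intro n hn
    simp only [Finset.mem_filter, Fintype.mem_piFinset, Finset.mem_Icc] at hn
    have := (hn.1 (Fin.last r)).1
    rw [Fin.prod_univ_castSucc, mul_comm]
    simp only [Nat.sub_add_cancel this, Fin.init, pow_one]

lemma cmzv_eq (r : ℕ) : ∀ (ε : Fin r → ℂ) (z : ℂ) (M : ℕ),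
    cmzvPartial r (fun _ => 1)
      (fun i => (if h : (i : ℕ) + 1 < r then ε ⟨(i : ℕ) + 1, h⟩ else z) / ε i) M =
    ∑ n ∈ Finset.range (M + 1), coefA r ε n * z ^ n := by
  induction r with
  | zero =>
    intro ε z M
    simp [cmzvPartial, coefA]
  | succ r ih =>
    intro ε z M
    rw [cmzv_succ]
    refine Finset.sum_congr rfl fun k _ => ?_
    rcases Nat.eq_zero_or_pos k with rfl | hk
    · simp [coefA]
    have h := ih (Fin.init ε) (ε (Fin.last r)) (k - 1)
    have h2 : Fin.init (fun i : Fin (r + 1) =>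
        (if h : (i : ℕ) + 1 < r + 1 then ε ⟨(i : ℕ) + 1, h⟩ else z) / ε i) =
        fun i : Fin r => (if h : (i : ℕ) + 1 < r then Fin.init ε ⟨(i : ℕ) + 1, h⟩
          else ε (Fin.last r)) / Fin.init ε i := by
      ext i
      have hi := i.2
      simp only [Fin.init, Fin.val_castSucc, Nat.add_lt_add_iff_right, hi, dite_true]
      congr 1
      split_ifs with h
      · rfl
      · congr 1
        ext
        simp
        omega
    rw [h2, h, Nat.sub_add_cancel hk, coefA]
    simp only [Fin.val_last, lt_self_iff_false, dite_false]
    rw [div_eq_mul_inv z, mul_pow]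
    rw [Finset.sum_congr rfl (fun m _ => mul_comm (coefA r (Fin.init ε) m) _)]
    ring

/-- For `N`-th roots of unity `ε₁, …, ε_r` with `ε_r ≠ 1`, the function
`(t₁,…,t_r) ↦ ∏ᵢ (εᵢ - tᵢ)⁻¹` is integrable on the open simplex, and its integral is the
cyclotomic multiple zeta value `ζ(1,…,1; ε₂/ε₁, …, ε_r/ε_{r-1}, 1/ε_r)`. -/
theorem iteratedIntegral_eq_cmzv (N r : ℕ) (hN : 1 ≤ N) (hr : 1 ≤ r)
    (ε : Fin r → ℂ) (hε : ∀ i, ε i ^ N = 1)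
    (hlast : ε ⟨r - 1, by omega⟩ ≠ 1) :
    IntegrableOn (fun t : Fin r → ℝ => ∏ i, (ε i - (t i : ℂ))⁻¹) (openSimplex r) ∧
    Tendsto
      (cmzvPartial r (fun _ => 1)
        (fun i => (if h : (i : ℕ) + 1 < r then ε ⟨(i : ℕ) + 1, h⟩ else 1) / ε i))
      atTop
      (𝓝 (∫ t in openSimplex r, ∏ i, (ε i - (t i : ℂ))⁻¹)) := by
  have hn : ∀ i, ‖ε i‖ = 1 := fun i => Complex.norm_eq_one_of_pow_eq_one (hε i) (by omega)
  obtain ⟨r, rfl⟩ : ∃ k, r = k + 1 := ⟨r - 1, by omega⟩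
  have hl : ε (Fin.last r) ≠ 1 := hlast
  have hcont : ContinuousOn (fun s : ℝ => (ε (Fin.last r) - (s : ℂ))⁻¹) (Set.Icc 0 1) := by
    refine ContinuousOn.inv₀ (by fun_prop) fun s hs h => hl ?_
    rw [sub_eq_zero] at h
    have h1 := hn (Fin.last r)
    rw [h, Complex.norm_real, Real.norm_of_nonneg hs.1] at h1
    rw [h, h1, Complex.ofReal_one]
  obtain ⟨K, hK⟩ := isCompact_Icc.exists_bound_of_continuousOn hcont
  obtain ⟨h1, h2⟩ := main_step r (Q_all r) ε hn 1 zero_le_one le_rfl K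
    (fun s hs => hK s (Set.Ioo_subset_Icc_self hs))
  refine ⟨h1, ?_⟩
  refine Tendsto.congr (fun M => ?_) h2
  rw [cmzv_eq]
  simp
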